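/- arXiv:2505.17976 — 2 statements merged into one kernel-verified Lean document; each statement's English description precedes it below -/
import Mathlib

section
/- Let (X,d) be a complete metric space and let (μₙ)_{n∈ℕ} be a sequence of Borel probability measures on X. Suppose that for every ε > 0 and δ > 0 there exists a compact set K^δ_ε ⊆ X such that liminf_{n→∞} μₙ(B_{K^δ_ε}(δ)) ≥ 1 − ε. Then (μₙ)_{n∈ℕ} is precompact in the topology of weak convergence, i.e. it admits a weakly convergent subsequence. -/
open MeasureTheory Filter Topology Metric

/-- In a complete metric space, a set of measures is tight as soon as, at every scale, all its
members are concentrated up to a small error near a common finite set. -/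
theorem isTightMeasureSet_of_exists_finite_thickening {X : Type*} [MetricSpace X]
    [CompleteSpace X] [MeasurableSpace X] {S : Set (Measure X)}
    (h : ∀ ε : ENNReal, 0 < ε → ∀ δ : ℝ, 0 < δ → ∃ F : Set X, F.Finite ∧
      ∀ μ ∈ S, μ (thickening δ F)ᶜ ≤ ε) :
    IsTightMeasureSet S := by
  rw [isTightMeasureSet_iff_exists_isCompact_measure_compl_le]
  intro ε hε
  obtain ⟨ε', hε', hsum⟩ := ENNReal.exists_pos_sum_of_countable' hε.ne' ℕ
  choose F hF hFS using fun j : ℕ ↦ h (ε' j) (hε' j) (1 / ((j : ℝ) + 1)) (by positivity)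
  refine ⟨⋂ j : ℕ, closure (thickening (1 / ((j : ℝ) + 1)) (F j)), ?_, fun μ hμ ↦ ?_⟩
  · refine TotallyBounded.isCompact_of_isClosed ?_ (isClosed_iInter fun _ ↦ isClosed_closure)
    refine totallyBounded_iff.2 fun δ hδ ↦ ?_
    obtain ⟨j, hj⟩ := exists_nat_one_div_lt hδ
    refine ⟨F j, hF j, fun x hx ↦ ?_⟩
    have hx' := cthickening_subset_thickening' hδ hj _
      (closure_thickening_subset_cthickening _ _ (Set.mem_iInter.1 hx j))
    simpa [mem_thickening_iff] using hx'
  · calc μ (⋂ j : ℕ, closure (thickening (1 / ((j : ℝ) + 1)) (F j)))ᶜ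
        ≤ μ (⋃ j : ℕ, (thickening (1 / ((j : ℝ) + 1)) (F j))ᶜ) := by
          rw [Set.compl_iInter]
          exact measure_mono (Set.iUnion_mono fun j ↦ Set.compl_subset_compl.2 subset_closure)
      _ ≤ ∑' j : ℕ, μ (thickening (1 / ((j : ℝ) + 1)) (F j))ᶜ := measure_iUnion_le _
      _ ≤ ∑' j, ε' j := ENNReal.tsum_le_tsum fun j ↦ hFS j μ hμ
      _ ≤ ε := hsum.le

/-- If the maps `T k` are close to the identity in probability and the images of `P k` under `T k`
converge weakly, then the measures `P k` themselves converge weakly to the same limit. -/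
theorem tendsto_probabilityMeasure_of_tendsto_map {X : Type*} [MetricSpace X]
    [MeasurableSpace X] [BorelSpace X] {P : ℕ → ProbabilityMeasure X} {ν : ProbabilityMeasure X}
    {T : ℕ → X → X} (hT : ∀ k, Measurable (T k))
    (hdist : ∀ ε : ℝ, 0 < ε →
      Tendsto (fun k ↦ (P k : Measure X) {x | ε ≤ dist x (T k x)}) atTop (𝓝 0))
    (hlim : Tendsto (fun k ↦ (P k).map (hT k).aemeasurable) atTop (𝓝 ν)) :
    Tendsto P atTop (𝓝 ν) := by
  rw [tendsto_iff_forall_lipschitz_integral_tendsto] at hlim ⊢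
  rintro f ⟨C, hC⟩ ⟨L, hL⟩
  obtain ⟨x₀⟩ : Nonempty X := (P 0).nonempty
  have hC0 : 0 ≤ C := dist_nonneg.trans (hC x₀ x₀)
  have hfm : Measurable f := hL.continuous.measurable
  have hfb (x : X) : ‖f x‖ ≤ ‖f x₀‖ + C := by
    have := norm_sub_norm_le (f x) (f x₀)
    have := hC x x₀
    rw [dist_eq_norm] at this
    linarith
  have hint (k : ℕ) : Integrable f (P k : Measure X) :=
    .of_bound hfm.aestronglyMeasurable _ (.of_forall hfb)
  have hintT (k : ℕ) : Integrable (fun x ↦ f (T k x)) (P k : Measure X) :=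
    .of_bound (hfm.comp (hT k)).aestronglyMeasurable _ (.of_forall fun x ↦ hfb _)
  have hmap (k : ℕ) : ∫ x, f x ∂((P k).map (hT k).aemeasurable : Measure X)
      = ∫ x, f (T k x) ∂(P k : Measure X) :=
    integral_map (hT k).aemeasurable hfm.aestronglyMeasurable
  have hlim' := hlim f ⟨C, hC⟩ ⟨L, hL⟩
  simp_rw [hmap] at hlim'
  refine (tendsto_iff_of_dist ?_).1 hlim'
  have hbound (ε : ℝ) (hε : 0 < ε) (k : ℕ) :
      dist (∫ x, f (T k x) ∂(P k : Measure X)) (∫ x, f x ∂(P k : Measure X))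
        ≤ L * ε + C * (P k : Measure X).real {x | ε ≤ dist x (T k x)} := by
    let B : Set X := {x | L * ε < ‖f (T k x) - f x‖}
    have hB : MeasurableSet B :=
      measurableSet_lt measurable_const ((hfm.comp (hT k)).sub hfm).norm
    have hBsub : B ⊆ {x | ε ≤ dist x (T k x)} := by
      intro x hx
      by_contra hlt
      have h1 := hL.dist_le_mul (T k x) x
      rw [dist_eq_norm, dist_comm] at h1
      have h2 : (L : ℝ) * dist x (T k x) ≤ L * ε :=
        mul_le_mul_of_nonneg_left (not_le.1 hlt).le L.2
      exact absurd hx (not_lt.2 (h1.trans h2))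
    have hpt (x : X) : ‖f (T k x) - f x‖ ≤ L * ε + B.indicator (fun _ ↦ C) x := by
      by_cases hx : x ∈ B
      · rw [Set.indicator_of_mem hx, ← dist_eq_norm]
        exact (hC _ _).trans (le_add_of_nonneg_left (by positivity))
      · rw [Set.indicator_of_notMem hx, add_zero]
        exact not_lt.1 hx
    have hind : Integrable (B.indicator fun _ ↦ C) (P k : Measure X) :=
      (integrable_const C).indicator hB
    calc dist (∫ x, f (T k x) ∂(P k : Measure X)) (∫ x, f x ∂(P k : Measure X))
        = ‖∫ x, (f (T k x) - f x) ∂(P k : Measure X)‖ := by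
          rw [dist_eq_norm, integral_sub (hintT k) (hint k)]
      _ ≤ ∫ x, (L * ε + B.indicator (fun _ ↦ C) x) ∂(P k : Measure X) :=
          norm_integral_le_of_norm_le ((integrable_const _).add hind) (.of_forall hpt)
      _ = L * ε + C * (P k : Measure X).real B := by
          rw [integral_add (integrable_const _) hind, integral_indicator_const _ hB]
          simp [mul_comm]
      _ ≤ L * ε + C * (P k : Measure X).real {x | ε ≤ dist x (T k x)} := by
          gcongr
          exact measure_ne_top _ _
  rw [Metric.tendsto_nhds]
  intro η hη
  obtain ⟨ε, hε, hLε⟩ : ∃ ε : ℝ, 0 < ε ∧ L * ε < η / 2 :=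
    exists_pos_mul_lt (half_pos hη) _
  have hreal : Tendsto (fun k ↦ C * (P k : Measure X).real {x | ε ≤ dist x (T k x)})
      atTop (𝓝 0) := by
    have h := ((ENNReal.tendsto_toReal ENNReal.zero_ne_top).comp (hdist ε hε)).const_mul C
    rwa [ENNReal.toReal_zero, mul_zero] at h
  filter_upwards [hreal.eventually_lt_const (half_pos hη)] with k hk
  rw [Real.dist_0_eq_abs, abs_of_nonneg dist_nonneg]
  linarith [hbound ε hε k]

/-- If a sequence of measures asymptotically concentrates near compact sets at every scale, then
these compact sets may be replaced by finite unions of balls centred at the terms of a single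
sequence of points. -/
theorem exists_seq_eventually_measure_compl_iUnion_ball_le {X : Type*} [MetricSpace X]
    [MeasurableSpace X] [BorelSpace X] (μ : ℕ → ProbabilityMeasure X)
    (htight : ∀ ε : ℝ, 0 < ε → ∀ δ : ℝ, 0 < δ → ∃ K : Set X, IsCompact K ∧
      ENNReal.ofReal (1 - ε) ≤
        liminf (fun n => (μ n : Measure X) (thickening δ K)) atTop)
    {u : ℕ → ℝ} (hu : ∀ j, 0 < u j) (hu1 : ∀ j, u j ≤ 1) :
    ∃ (e : ℕ → X) (N : ℕ → ℕ), Monotone N ∧ ∀ j, ∀ᶠ n in atTop,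
      (μ n : Measure X) (⋃ i ≤ N j, ball (e i) (u j))ᶜ ≤ ENNReal.ofReal (u j) := by
  choose K hK hKμ using fun j ↦ htight (u j / 2) (half_pos (hu j)) (u j / 2) (half_pos (hu j))
  obtain ⟨x₀⟩ : Nonempty X := (μ 0).nonempty
  obtain ⟨c, hc, hKc⟩ := TopologicalSpace.IsSeparable.iUnion fun j ↦ (hK j).isSeparable
  obtain ⟨e, he⟩ := (hc.insert x₀).exists_eq_range (Set.insert_nonempty _ _)
  have hcover (j : ℕ) : ∃ N : ℕ, K j ⊆ ⋃ i ≤ N, ball (e i) (u j / 2) := by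
    refine (hK j).elim_directed_cover (fun N ↦ ⋃ i ≤ N, ball (e i) (u j / 2))
      (fun N ↦ isOpen_iUnion fun _ ↦ isOpen_iUnion fun _ ↦ isOpen_ball) (fun x hx ↦ ?_)
      (Monotone.directed_le fun a b hab ↦
        Set.biUnion_subset_biUnion_left fun i (hi : i ≤ a) ↦ hi.trans hab)
    have hxc : x ∈ closure (Set.range e) := by
      rw [← he]
      exact closure_mono (Set.subset_insert _ _) (hKc (Set.mem_iUnion_of_mem j hx))
    obtain ⟨i, hi⟩ := mem_closure_range_iff.1 hxc _ (half_pos (hu j))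
    simp only [Set.mem_iUnion]
    exact ⟨i, i, le_rfl, hi⟩
  choose N hN using hcover
  refine ⟨e, partialSups N, (partialSups N).monotone, fun j ↦ ?_⟩
  have hsub : thickening (u j / 2) (K j) ⊆ ⋃ i ≤ partialSups N j, ball (e i) (u j) := by
    intro x hx
    obtain ⟨y, hy, hxy⟩ := mem_thickening_iff.1 hx
    have hyN := hN j hy
    simp only [Set.mem_iUnion, mem_ball] at hyN ⊢
    obtain ⟨i, hi, hyi⟩ := hyN
    exact ⟨i, hi.trans (le_partialSups N j), by linarith [dist_triangle x y (e i)]⟩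
  have hlt : ENNReal.ofReal (1 - u j)
      < liminf (fun n => (μ n : Measure X) (thickening (u j / 2) (K j))) atTop := by
    refine lt_of_lt_of_le ?_ (hKμ j)
    rw [ENNReal.ofReal_lt_ofReal_iff] <;> linarith [hu j, hu1 j]
  filter_upwards [eventually_lt_of_lt_liminf hlt] with n hn
  have hmeas : MeasurableSet (⋃ i ≤ partialSups N j, ball (e i) (u j)) :=
    (isOpen_iUnion fun _ ↦ isOpen_iUnion fun _ ↦ isOpen_ball).measurableSet
  rw [prob_compl_eq_one_sub hmeas, tsub_le_iff_right]
  calc (1 : ENNReal) = ENNReal.ofReal (u j) + ENNReal.ofReal (1 - u j) := by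
        rw [← ENNReal.ofReal_add (hu j).le (by linarith [hu1 j])]
        simp
    _ ≤ _ := by
        gcongr
        exact hn.le.trans (measure_mono hsub)

/-- In a separable metric space, every tight sequence of probability measures has a weakly
convergent subsequence. -/
theorem exists_subseq_tendsto_of_isTightMeasureSet {S : Type*} [MetricSpace S]
    [TopologicalSpace.SeparableSpace S] [MeasurableSpace S] [BorelSpace S]
    {P : ℕ → ProbabilityMeasure S}
    (h : IsTightMeasureSet (Set.range fun k ↦ (P k : Measure S))) :
    ∃ ψ : ℕ → ℕ, StrictMono ψ ∧ ∃ ν, Tendsto (P ∘ ψ) atTop (𝓝 ν) := by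
  have hcomp : IsCompact (closure (Set.range P)) := by
    refine isCompact_closure_of_isTightMeasureSet (h.subset ?_)
    rintro _ ⟨_, ⟨k, rfl⟩, rfl⟩
    exact ⟨k, rfl⟩
  obtain ⟨ν, -, ψ, hψ, hν⟩ :=
    hcomp.tendsto_subseq fun k ↦ subset_closure (Set.mem_range_self k)
  exact ⟨ψ, hψ, ν, hν⟩

/-- Let `(X,d)` be a complete metric space and `(μₙ)` a sequence of Borel
probability measures such that for all `ε, δ > 0` there is a compact set `K` with
`liminf μₙ(B_K(δ)) ≥ 1 - ε`.  Then `(μₙ)` is precompact in the topology of weak convergence: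
every subsequence admits a weakly convergent sub-subsequence. -/
theorem seq_tight_complete_space_precompact
    {X : Type*} [MetricSpace X] [CompleteSpace X] [MeasurableSpace X] [BorelSpace X]
    (μ : ℕ → ProbabilityMeasure X)
    (htight : ∀ ε : ℝ, 0 < ε → ∀ δ : ℝ, 0 < δ → ∃ K : Set X, IsCompact K ∧
      ENNReal.ofReal (1 - ε) ≤
        Filter.liminf (fun n => (μ n : Measure X) (Metric.thickening δ K)) Filter.atTop) :
    ∀ φ : ℕ → ℕ, StrictMono φ →
      ∃ ψ : ℕ → ℕ, StrictMono ψ ∧ ∃ ν : ProbabilityMeasure X,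
        Filter.Tendsto (fun j => μ (φ (ψ j))) Filter.atTop (𝓝 ν) := by
  intro φ hφ
  let u : ℕ → ℝ := fun j ↦ (1 / 2) ^ j
  have hu (j : ℕ) : 0 < u j := by positivity
  have hu_lim : Tendsto u atTop (𝓝 0) :=
    tendsto_pow_atTop_nhds_zero_of_lt_one (by norm_num) (by norm_num)
  have hu1 (j : ℕ) : u j ≤ 1 := pow_le_one₀ (by norm_num) (by norm_num)
  obtain ⟨e, N, hN, heN⟩ :=
    exists_seq_eventually_measure_compl_iUnion_ball_le μ htight hu hu1
  obtain ⟨ψ₀, hψ₀, hA⟩ := extraction_forall_of_eventually fun k : ℕ ↦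
    (eventually_all_finite (Set.finite_Iic k)).2 fun j _ ↦ hφ.tendsto_atTop.eventually (heN j)
  have hnear {k j : ℕ} {x : X} (hjk : j ≤ k) (hx : x ∈ ⋃ i ≤ N j, ball (e i) (u j)) :
      dist x (SimpleFunc.nearestPt e (N k) x) < u j := by
    simp only [Set.mem_iUnion, mem_ball] at hx
    obtain ⟨i, hi, hxi⟩ := hx
    have h := SimpleFunc.edist_nearestPt_le e x (hi.trans (hN hjk))
    rw [edist_dist, edist_dist, ENNReal.ofReal_le_ofReal_iff dist_nonneg] at h
    rw [dist_comm] at hxi ⊢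
    exact h.trans_lt hxi
  -- The approximating measures live on a closed separable subspace.
  let S : Set X := closure (Set.range e)
  have : TopologicalSpace.SeparableSpace S :=
    (Set.countable_range e).isSeparable.closure.separableSpace
  have : CompleteSpace S := isClosed_closure.completeSpace_coe
  let e' : ℕ → S := fun i ↦ ⟨e i, subset_closure (Set.mem_range_self i)⟩
  let T (k : ℕ) (x : X) : S := e' (SimpleFunc.nearestPtInd e (N k) x)
  have hT (k : ℕ) : Measurable (T k) :=
    (measurable_from_nat (f := e')).comp (SimpleFunc.nearestPtInd e (N k)).measurable
  have hTval (k : ℕ) (x : X) : (T k x : X) = SimpleFunc.nearestPt e (N k) x := rfl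
  let P (k : ℕ) : ProbabilityMeasure X := μ (φ (ψ₀ k))
  let Q (k : ℕ) : ProbabilityMeasure S := (P k).map (hT k).aemeasurable
  have hQ : IsTightMeasureSet (Set.range fun k ↦ (Q k : Measure S)) := by
    refine isTightMeasureSet_of_exists_finite_thickening fun ε hε δ hδ ↦ ?_
    obtain ⟨j, hjδ, hjε⟩ : ∃ j, 2 * u j < δ ∧ ENNReal.ofReal (u j) < ε := by
      have h1 : Tendsto (fun j ↦ 2 * u j) atTop (𝓝 0) := by simpa using hu_lim.const_mul 2
      have h2 : Tendsto (fun j ↦ ENNReal.ofReal (u j)) atTop (𝓝 0) := by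
        simpa using ENNReal.tendsto_ofReal hu_lim
      exact ((h1.eventually_lt_const hδ).and (h2.eventually_lt_const hε)).exists
    refine ⟨e' '' Set.Iic (N j), (Set.finite_Iic _).image _, ?_⟩
    rintro _ ⟨k, rfl⟩
    change ((P k : Measure X).map (T k)) _ ≤ ε
    rw [Measure.map_apply (hT k) isOpen_thickening.measurableSet.compl]
    rcases le_or_gt j k with hjk | hkj
    · refine (measure_mono ?_).trans ((hA k j hjk).trans hjε.le)
      rw [Set.preimage_compl, Set.compl_subset_compl]
      intro x hx
      have hxT := hnear hjk hx
      simp only [Set.mem_iUnion, mem_ball] at hx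
      obtain ⟨i, hi, hxi⟩ := hx
      refine mem_thickening_iff.2 ⟨e' i, Set.mem_image_of_mem _ hi, ?_⟩
      rw [Subtype.dist_eq, hTval]
      have := dist_triangle_left (SimpleFunc.nearestPt e (N k) x) (e i) x
      change dist _ (e i) < δ
      linarith
    · have hempty : T k ⁻¹' (thickening δ (e' '' Set.Iic (N j)))ᶜ = ∅ := by
        refine Set.eq_empty_of_forall_notMem fun x hx ↦ hx ?_
        exact self_subset_thickening hδ _ (Set.mem_image_of_mem _
          ((SimpleFunc.nearestPtInd_le e (N k) x).trans (hN hkj.le)))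
      simp [hempty]
  obtain ⟨ψ₁, hψ₁, ν, hν⟩ := exists_subseq_tendsto_of_isTightMeasureSet hQ
  refine ⟨ψ₀ ∘ ψ₁, hψ₀.comp hψ₁, ν.map measurable_subtype_coe.aemeasurable, ?_⟩
  refine tendsto_probabilityMeasure_of_tendsto_map (P := fun k ↦ P (ψ₁ k))
    (T := fun k x ↦ (T (ψ₁ k) x : X)) (fun k ↦ measurable_subtype_coe.comp (hT _)) ?_ ?_
  · intro ε hε
    refine Tendsto.comp (g := fun k ↦ (P k : Measure X) {x | ε ≤ dist x (T k x : X)})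
      ?_ hψ₁.tendsto_atTop
    have h2 : Tendsto (fun j ↦ ENNReal.ofReal (u j)) atTop (𝓝 0) := by
      simpa using ENNReal.tendsto_ofReal hu_lim
    refine tendsto_of_tendsto_of_tendsto_of_le_of_le' tendsto_const_nhds h2
      (.of_forall fun _ ↦ zero_le) ?_
    filter_upwards [hu_lim.eventually_lt_const hε] with k hk
    refine (measure_mono fun x hx hxA ↦ ?_).trans (hA k k Set.self_mem_Iic)
    exact absurd (hnear le_rfl hxA) (not_lt.2 (hk.le.trans hx))
  · convert ProbabilityMeasure.tendsto_map_of_tendsto_of_continuous _ _ hν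
      continuous_subtype_val using 2 with k
    apply Subtype.ext
    exact (Measure.map_map measurable_subtype_coe (hT _)).symm
end

section
/- Let X be a metric space and Y ⊆ X a separable closed subset. Suppose 𝒞 is a precompact subset of ℳ_{≤1}(X), the space of Borel measures on X of total mass at most 1 with the topology of weak convergence. Then the set of restricted measures 𝒞|_Y := {μ|_Y : μ ∈ 𝒞}, regarded as a subset of ℳ_{≤1}(Y), is also precompact. -/
open MeasureTheory Filter Topology Metric

/-- A positive linear functional on bounded continuous functions that is dominated by integration
against a finite measure is itself integration against a finite measure. -/
theorem exists_finiteMeasure_integral_eq_of_dominated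
    {Y : Type*} [MetricSpace Y] [MeasurableSpace Y] [BorelSpace Y]
    (ρ : Measure Y) [IsFiniteMeasure ρ]
    (Λ : BoundedContinuousFunction Y ℝ →ₗ[ℝ] ℝ)
    (hpos : ∀ f, 0 ≤ f → 0 ≤ Λ f)
    (hdom : ∀ f, 0 ≤ f → Λ f ≤ ∫ y, f y ∂ρ) :
    ∃ ν : FiniteMeasure Y, ∀ f : BoundedContinuousFunction Y ℝ,
      Λ f = ∫ y, f y ∂(ν : Measure Y) := by
  let e : BoundedContinuousFunction Y ℝ →L[ℝ] Lp ℝ 2 ρ :=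
    BoundedContinuousFunction.toLp 2 ρ ℝ
  have he (f : BoundedContinuousFunction Y ℝ) : e f =ᵐ[ρ] f :=
    BoundedContinuousFunction.coeFn_toLp (p := 2) ρ ℝ f
  have habs (f : BoundedContinuousFunction Y ℝ) : e |f| = |e f| := by
    apply Lp.ext
    filter_upwards [he |f|, he f, Lp.coeFn_abs (e f)] with y h₁ h₂ h₃
    rw [h₁, h₃, h₂]
    rfl
  have hdense : DenseRange e.toLinearMap :=
    BoundedContinuousFunction.toLp_denseRange ℝ ρ ℝ (by simp)
  have hΛabs (f : BoundedContinuousFunction Y ℝ) : |Λ f| ≤ Λ |f| := by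
    have h₁ := hpos (|f| - f) (sub_nonneg.2 (le_abs_self f))
    have h₂ := hpos (|f| + f) (neg_le_iff_add_nonneg.1 (neg_le_abs f))
    rw [map_sub] at h₁
    rw [map_add] at h₂
    exact abs_le.2 ⟨by linarith, by linarith⟩
  have hbound (f : BoundedContinuousFunction Y ℝ) :
      ‖Λ f‖ ≤ ‖e 1‖ * ‖e.toLinearMap f‖ := by
    calc ‖Λ f‖ ≤ ∫ y, |f| y ∂ρ := (hΛabs f).trans (hdom _ (abs_nonneg f))
      _ = inner ℝ (e 1) (e |f|) := by
        rw [L2.inner_def]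
        apply integral_congr_ae
        filter_upwards [he 1, he |f|] with y h₁ h₂
        simp [h₁, h₂]
      _ ≤ ‖e 1‖ * ‖e |f|‖ := real_inner_le_norm _ _
      _ = ‖e 1‖ * ‖e.toLinearMap f‖ := by
        rw [habs, norm_abs_eq_norm]
        rfl
  let L : Lp ℝ 2 ρ →L[ℝ] ℝ := Λ.extendOfNorm e.toLinearMap
  have hL (f : BoundedContinuousFunction Y ℝ) : L (e f) = Λ f :=
    LinearMap.extendOfNorm_eq hdense ⟨_, hbound⟩ f
  have hLpos (h : Lp ℝ 2 ρ) : 0 ≤ L |h| := by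
    refine hdense.induction_on (p := fun h ↦ 0 ≤ L |h|) h ?_ fun f ↦ ?_
    · exact isClosed_le continuous_const (L.continuous.comp (continuous_id.sup continuous_neg))
    · change 0 ≤ L |e f|
      rw [← habs, hL]
      exact hpos _ (abs_nonneg f)
  let g : Lp ℝ 2 ρ := (InnerProductSpace.toDual ℝ (Lp ℝ 2 ρ)).symm L
  have hg (h : Lp ℝ 2 ρ) : inner ℝ g h = L h := InnerProductSpace.toDual_symm_apply
  have hgint : Integrable g ρ := (Lp.memLp g).integrable (by norm_num)
  have hgnonneg : 0 ≤ᵐ[ρ] g := by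
    refine ae_nonneg_of_forall_setIntegral_nonneg hgint fun s hs hρs ↦ ?_
    rw [← L2.inner_indicatorConstLp_one (𝕜 := ℝ) hs hρs.ne g, real_inner_comm, hg]
    have h : |indicatorConstLp 2 hs hρs.ne (1 : ℝ)| = indicatorConstLp 2 hs hρs.ne (1 : ℝ) := by
      apply abs_of_nonneg
      rw [← Lp.coeFn_nonneg]
      filter_upwards [indicatorConstLp_coeFn (p := 2) (hs := hs) (hμs := hρs.ne) (c := (1 : ℝ))]
        with y hy
      rw [hy]
      exact Set.indicator_nonneg (fun _ _ ↦ zero_le_one) y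
    rw [← h]
    exact hLpos _
  have hfin : IsFiniteMeasure (ρ.withDensity fun y ↦ ENNReal.ofReal (g y)) :=
    isFiniteMeasure_withDensity_ofReal hgint.2
  refine ⟨⟨_, hfin⟩, fun f ↦ ?_⟩
  change Λ f = ∫ y, f y ∂(ρ.withDensity fun y ↦ ENNReal.ofReal (g y))
  rw [integral_withDensity_eq_integral_toReal_smul₀
    hgint.1.aemeasurable.ennreal_ofReal (by simp), ← hL, ← hg, L2.inner_def]
  apply integral_congr_ae
  filter_upwards [he f, hgnonneg] with y h₁ h₂
  simp only [Pi.zero_apply] at h₂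
  simp [h₁, ENNReal.toReal_ofReal h₂, mul_comm]

/-- A bound for functionals tested on nonnegative functions on the whole space localizes to a
closed subset. -/
theorem le_integral_comap_of_forall_le_integral
    {X : Type*} [MetricSpace X] [MeasurableSpace X] [BorelSpace X]
    {Y : Set X} (hY : IsClosed Y) (μ : Measure X) [IsFiniteMeasure μ]
    {f : BoundedContinuousFunction Y ℝ} (hf : 0 ≤ f) {c : ℝ}
    (hc : ∀ F : BoundedContinuousFunction X ℝ, 0 ≤ F → (∀ y : Y, F y = f y) →
      c ≤ ∫ x, F x ∂μ) :
    c ≤ ∫ y, f y ∂(μ.comap (Subtype.val : Y → X)) := by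
  obtain ⟨G, -, hG⟩ := f.exists_norm_eq_domRestrict_eq_of_closed hY
  let A : BoundedContinuousFunction X ℝ := |G|
  have hAf (y : Y) : A y = f y := by
    rw [← hG]
    have h := hf y
    rw [← hG] at h
    exact abs_of_nonneg h
  let δ : ℕ → ℝ := fun n ↦ 1 / ((n : ℝ) + 1)
  have hδ (n : ℕ) : 0 < δ n := Nat.one_div_pos_of_nat
  let φ (n : ℕ) (x : X) : ℝ := (thickenedIndicator (hδ n) Y x : ℝ)
  have hφcont (n : ℕ) : Continuous (φ n) :=
    NNReal.continuous_coe.comp (thickenedIndicator (hδ n) Y).continuous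
  have hφ_le (n : ℕ) (x : X) : φ n x ≤ 1 :=
    NNReal.coe_le_one.2 (thickenedIndicator_le_one (hδ n) Y x)
  have hφ_nonneg (n : ℕ) (x : X) : 0 ≤ φ n x := NNReal.coe_nonneg _
  have hnorm (n : ℕ) (x : X) : ‖φ n x * A x‖ ≤ ‖A‖ := by
    rw [norm_mul, Real.norm_of_nonneg (hφ_nonneg n x)]
    exact (mul_le_of_le_one_left (norm_nonneg _) (hφ_le n x)).trans (A.norm_coe_le_norm x)
  let F (n : ℕ) : BoundedContinuousFunction X ℝ :=
    BoundedContinuousFunction.ofNormedAddCommGroup (fun x ↦ φ n x * A x)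
      ((hφcont n).mul A.continuous) ‖A‖ (hnorm n)
  have hlim : Tendsto (fun n ↦ ∫ x, F n x ∂μ) atTop (𝓝 (∫ x, Y.indicator A x ∂μ)) := by
    refine tendsto_integral_of_dominated_convergence (fun _ ↦ ‖A‖)
      (fun n ↦ (F n).continuous.aestronglyMeasurable) (integrable_const _)
      (fun n ↦ ae_of_all _ (hnorm n)) (ae_of_all _ fun x ↦ ?_)
    have h := tendsto_pi_nhds.1 (thickenedIndicator_tendsto_indicator_closure hδ
      tendsto_one_div_add_atTop_nhds_zero_nat Y) x
    rw [hY.closure_eq] at h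
    have h' := ((NNReal.continuous_coe.tendsto _).comp h).mul_const (A x)
    convert! h' using 2
    by_cases hx : x ∈ Y <;> simp [hx]
  have hle : c ≤ ∫ x, Y.indicator A x ∂μ := by
    refine ge_of_tendsto' hlim fun n ↦ hc _ (fun x ↦ ?_) fun y ↦ ?_
    · exact mul_nonneg (hφ_nonneg n x) (abs_nonneg (G x))
    · change φ n y * A y = f y
      simp only [φ, thickenedIndicator_one (hδ n) Y y.2, NNReal.coe_one, one_mul, hAf]
  rwa [integral_indicator hY.measurableSet, ← integral_subtype_comap hY.measurableSet,
    integral_congr_ae (ae_of_all _ hAf)] at hle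

/-- The finite measures on a closed subset which are dominated, on nonnegative bounded continuous
functions, by some member of a compact set of finite measures form a compact set. -/
theorem isCompact_setOf_dominated
    {X : Type*} [MetricSpace X] [MeasurableSpace X] [BorelSpace X]
    {Y : Set X} (hY : IsClosed Y) {K : Set (FiniteMeasure X)} (hK : IsCompact K) :
    IsCompact {ν : FiniteMeasure Y | ∃ μ ∈ K, ∀ F : BoundedContinuousFunction X ℝ, 0 ≤ F →
      ∫ y, F (y : X) ∂(ν : Measure Y) ≤ ∫ x, F x ∂(μ : Measure X)} := by
  rw [isCompact_iff_ultrafilter_le_nhds']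
  intro 𝒰 h𝒰
  have hex : ∀ ν : FiniteMeasure Y, (∃ μ ∈ K, ∀ F : BoundedContinuousFunction X ℝ, 0 ≤ F →
      ∫ y, F (y : X) ∂(ν : Measure Y) ≤ ∫ x, F x ∂(μ : Measure X)) →
      ∃ μ ∈ K, ∀ F : BoundedContinuousFunction X ℝ, 0 ≤ F →
        ∫ y, F (y : X) ∂(ν : Measure Y) ≤ ∫ x, F x ∂(μ : Measure X) := fun _ h ↦ h
  choose! m hm using hex
  obtain ⟨μ, hμK, hμ⟩ := hK.ultrafilter_le_nhds' (𝒰.map m)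
    (by
      rw [Ultrafilter.mem_map]
      exact mem_of_superset h𝒰 fun ν hν ↦ (hm ν hν).1)
  have hμlim := FiniteMeasure.tendsto_iff_forall_integral_tendsto.1
    (show Tendsto m 𝒰 (𝓝 μ) from hμ)
  have hdom : ∀ᶠ ν : FiniteMeasure Y in 𝒰, ∀ F : BoundedContinuousFunction X ℝ, 0 ≤ F →
      ∫ y, F (y : X) ∂(ν : Measure Y) ≤ ∫ x, F x ∂(m ν : Measure X) :=
    mem_of_superset h𝒰 fun ν hν ↦ (hm ν hν).2
  have hmass : ∀ᶠ ν : FiniteMeasure Y in 𝒰,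
      (ν : Measure Y).real Set.univ ≤ (μ : Measure X).real Set.univ + 1 := by
    have h := hμlim 1
    simp only [BoundedContinuousFunction.coe_one, Pi.one_apply, integral_const, smul_eq_mul,
      mul_one] at h
    filter_upwards [h.eventually_le_const (lt_add_one _), hdom] with ν h₁ h₂
    have h₃ := h₂ 1 fun _ ↦ zero_le_one
    simp only [BoundedContinuousFunction.coe_one, Pi.one_apply, integral_const, smul_eq_mul,
      mul_one] at h₃
    exact h₃.trans h₁
  have hlim (f : BoundedContinuousFunction Y ℝ) :
      ∃ c, Tendsto (fun ν : FiniteMeasure Y ↦ ∫ y, f y ∂(ν : Measure Y)) 𝒰 (𝓝 c) := by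
    let M := ((μ : Measure X).real Set.univ + 1) * ‖f‖
    obtain ⟨c, -, hc⟩ := (isCompact_closedBall (0 : ℝ) M).ultrafilter_le_nhds'
      (𝒰.map fun ν : FiniteMeasure Y ↦ ∫ y, f y ∂(ν : Measure Y)) <| by
        rw [Ultrafilter.mem_map]
        refine mem_of_superset hmass fun ν hν ↦ ?_
        rw [Set.mem_preimage, mem_closedBall_zero_iff]
        exact (f.norm_integral_le_mul_norm _).trans
          (mul_le_mul_of_nonneg_right hν (norm_nonneg f))
    exact ⟨c, hc⟩
  choose lim hlim using hlim
  let Λ : BoundedContinuousFunction Y ℝ →ₗ[ℝ] ℝ :=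
    { toFun := lim
      map_add' := fun f g ↦ tendsto_nhds_unique (hlim (f + g)) <| by
        convert (hlim f).add (hlim g) using 2 with ν
        exact integral_add (f.integrable _) (g.integrable _)
      map_smul' := fun a f ↦ tendsto_nhds_unique (hlim (a • f)) <| by
        rw [RingHom.id_apply, smul_eq_mul]
        convert (hlim f).const_mul a using 2 with ν
        exact integral_const_mul a _ }
  have hΛdom (F : BoundedContinuousFunction X ℝ) (hF : 0 ≤ F) (f : BoundedContinuousFunction Y ℝ)
      (hFf : ∀ y : Y, F y = f y) : Λ f ≤ ∫ x, F x ∂(μ : Measure X) := by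
    refine le_of_tendsto_of_tendsto (hlim f) (hμlim F) ?_
    filter_upwards [hdom] with ν hν
    simpa only [hFf] using hν F hF
  obtain ⟨ν, hν⟩ := exists_finiteMeasure_integral_eq_of_dominated
    ((μ : Measure X).comap (Subtype.val : Y → X)) Λ
    (fun f hf ↦ ge_of_tendsto' (hlim f) fun ν ↦ integral_nonneg hf)
    (fun f hf ↦ le_integral_comap_of_forall_le_integral hY μ hf
      fun F hF hFf ↦ hΛdom F hF f hFf)
  refine ⟨ν, ⟨μ, hμK, fun F hF ↦ ?_⟩, ?_⟩
  · let f : BoundedContinuousFunction Y ℝ :=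
      F.compContinuous ⟨Subtype.val, continuous_subtype_val⟩
    exact (hν f).symm.trans_le (hΛdom F hF f fun _ ↦ rfl)
  · refine FiniteMeasure.tendsto_iff_forall_integral_tendsto.2 (fun f ↦ ?_)
    rw [← hν f]
    exact hlim f

/-- Let `X` be a metric space and `Y ⊆ X` a separable closed subset.  If `𝒞` is
a precompact set of Borel measures on `X` of total mass at most `1` (with the topology of weak
convergence), then the set of restrictions `{μ|_Y : μ ∈ 𝒞}`, viewed as measures on the subspace
`Y`, is precompact as well. -/
theorem restriction_to_closed_separable_precompact
    {X : Type*} [MetricSpace X] [MeasurableSpace X] [BorelSpace X]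
    (Y : Set X) (hYclosed : IsClosed Y) (hYsep : TopologicalSpace.IsSeparable Y)
    (C : Set (FiniteMeasure X))
    (hmass : ∀ μ ∈ C, μ.mass ≤ 1)
    (hpre : IsCompact (closure C)) :
    IsCompact (closure {ν : FiniteMeasure Y |
      ∃ μ ∈ C, (ν : Measure Y) = Measure.comap (Subtype.val : Y → X) (μ : Measure X)}) := by
  refine (isCompact_setOf_dominated hYclosed hpre).closure_of_subset ?_
  rintro ν ⟨μ, hμ, hν⟩
  refine ⟨μ, subset_closure hμ, fun F hF ↦ ?_⟩
  rw [hν, integral_subtype_comap hYclosed.measurableSet]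
  exact setIntegral_le_integral (F.integrable _) (ae_of_all _ hF)
end
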